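/- For every j ≥ 1 the polynomial of the second kind is given by the determinant formula Q_j(λ) = ε_0 (b_0 b_1 ⋯ b_{j−1})^{−1} det(λ·I − H_{[1,j−1]}), where for j = 1 the matrix H_{[1,0]} is the empty 0×0 matrix and the determinant is 1. -/

import Mathlib

open Polynomial

/-- Polynomials of the first kind: `P_0 = 1`, `P_1 = p_0 / b_0`, and
`b_{j+1} P_{j+2} = p_{j+1} P_{j+1} - ε_j ε_{j+1} b_j P_j`. -/
noncomputable def genP (ε b : ℕ → ℝ) (p : ℕ → Polynomial ℝ) : ℕ → Polynomial ℝ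
  | 0 => 1
  | 1 => Polynomial.C (b 0)⁻¹ * p 0
  | (j + 2) => Polynomial.C (b (j + 1))⁻¹ *
      (p (j + 1) * genP ε b p (j + 1) -
        Polynomial.C (ε j * ε (j + 1) * b j) * genP ε b p j)

/-- Polynomials of the second kind: `Q_0 = 0`, `Q_1 = ε_0 / b_0`, same recurrence. -/
noncomputable def genQ (ε b : ℕ → ℝ) (p : ℕ → Polynomial ℝ) : ℕ → Polynomial ℝ
  | 0 => 0
  | 1 => Polynomial.C (ε 0 / b 0)
  | (j + 2) => Polynomial.C (b (j + 1))⁻¹ *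
      (p (j + 1) * genQ ε b p (j + 1) -
        Polynomial.C (ε j * ε (j + 1) * b j) * genQ ε b p j)

/-- `nsum k j = n_j = k_0 + ⋯ + k_{j-1}`. -/
def nsum (k : ℕ → ℕ) (j : ℕ) : ℕ := ∑ i ∈ Finset.range j, k i

/-- The index `i` of the block containing the global row/column index `r`,
i.e. the greatest `i` with `n_i ≤ r` (assuming all `k i ≥ 1`). -/
def blkIdx (k : ℕ → ℕ) (r : ℕ) : ℕ := Nat.findGreatest (fun i => nsum k i ≤ r) r

/-- Entry of the (infinite) generalized Jacobi matrix at global position `(r, c)`: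
diagonal blocks are companion matrices `C_{p_i}`, subdiagonal blocks `B_i` have the
single nonzero entry `b_i` in the top-right corner, superdiagonal blocks `B̃_i` have
the single nonzero entry `ε_i ε_{i+1} b_i` in the top-right corner. -/
noncomputable def Jentry (ε b : ℕ → ℝ) (p : ℕ → Polynomial ℝ) (k : ℕ → ℕ) (r c : ℕ) : ℝ :=
  let i := blkIdx k r
  let i' := blkIdx k c
  let a := r - nsum k i
  let a' := c - nsum k i'
  if i = i' then
    (if a' = k i - 1 then -((p i).coeff a) else if a = a' + 1 then 1 else 0)
  else if i = i' + 1 then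
    (if a = 0 ∧ a' = k i' - 1 then b i' else 0)
  else if i' = i + 1 then
    (if a = 0 ∧ a' = k i' - 1 then ε i * ε i' * b i else 0)
  else 0

/-- The finite generalized Jacobi matrix built from the blocks indexed `0, …, m-1`;
it has size `n_m × n_m`.  Thus `H_{[0,j]} = JmatN ε b p k (j+1)`. -/
noncomputable def JmatN (ε b : ℕ → ℝ) (p : ℕ → Polynomial ℝ) (k : ℕ → ℕ) (m : ℕ) :
    Matrix (Fin (nsum k m)) (Fin (nsum k m)) ℝ :=
  Matrix.of fun r c => Jentry ε b p k (r : ℕ) (c : ℕ)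

section Hessenberg

open scoped Matrix

/-- Determinant of an upper Hessenberg matrix `M`, given a row vector `w` with `w 0 = 1` such that
`w ᵥ* M` vanishes except at the last position. -/
theorem Matrix.det_of_upperHessenberg {R : Type*} [CommRing R] {n : ℕ}
    (M : Matrix (Fin (n + 1)) (Fin (n + 1)) R) (w : Fin (n + 1) → R) (hw : w 0 = 1)
    (hM : ∀ i j : Fin (n + 1), (j : ℕ) + 1 < i → M i j = 0)
    (hv : ∀ j : Fin n, (w ᵥ* M) j.castSucc = 0) :
    M.det = (-1) ^ n * (w ᵥ* M) (Fin.last n) * ∏ j : Fin n, M j.succ j.castSucc := by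
  have hrow : (∑ i, w i • M i) = w ᵥ* M := by
    ext j
    simp [Matrix.vecMul, dotProduct]
  have hdet : M.det = (M.updateRow 0 (w ᵥ* M)).det := by
    have h := Matrix.det_updateRow_sum M 0 w
    rw [hrow, hw, one_smul] at h
    exact h.symm
  rw [hdet, Matrix.det_succ_row_zero, Fin.sum_univ_castSucc]
  simp only [Matrix.updateRow_self, hv, mul_zero, zero_mul, Finset.sum_const_zero, zero_add,
    Fin.val_last]
  congr 1
  rw [Matrix.det_of_isUpperTriangular]
  · simp [Matrix.submatrix_apply]
  · intro i j hij
    rw [Matrix.submatrix_apply, Matrix.updateRow_ne (Fin.succ_ne_zero i), Fin.succAbove_last]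
    apply hM
    have : (j : ℕ) < i := hij
    simpa using this

/-- Characteristic polynomials of the truncations of an infinite upper Hessenberg matrix, in terms
of a formal left eigenvector `w`. -/
theorem Matrix.charpoly_of_upperHessenberg {R : Type*} [CommRing R] (H : ℕ → ℕ → R)
    (w : ℕ → R[X]) (hw : w 0 = 1) (hH : ∀ r c, c + 1 < r → H r c = 0)
    (hrec : ∀ c, X * w c = ∑ r ∈ Finset.range (c + 2), C (H r c) * w r) (N : ℕ) :
    (Matrix.of fun r c : Fin N => H r c).charpoly
      = C (∏ c ∈ Finset.range N, H (c + 1) c) * w N := by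
  cases N with
  | zero => simp [Matrix.charpoly, hw]
  | succ n =>
    have hvec (c : Fin (n + 1)) :
        ((fun r : Fin (n + 1) => w r) ᵥ* (Matrix.of fun r c : Fin (n + 1) => H r c).charmatrix) c
          = X * w c - ∑ r ∈ Finset.range (n + 1), C (H r c) * w r := by
      simp only [Matrix.charmatrix, Matrix.vecMul_sub, Pi.sub_apply]
      congr 1
      · simp [Matrix.vecMul, dotProduct, Matrix.scalar_apply, Matrix.diagonal_apply, mul_comm]
      · simp [Matrix.vecMul, dotProduct, Finset.sum_range, mul_comm]
    rw [Matrix.charpoly, Matrix.det_of_upperHessenberg _ (fun r : Fin (n + 1) => w r) (by simpa)]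
    · have hprod : ∏ j : Fin n,
          (Matrix.of fun r c : Fin (n + 1) => H r c).charmatrix j.succ j.castSucc
            = (-1) ^ n * C (∏ c ∈ Finset.range n, H (c + 1) c) := by
        rw [map_prod, Finset.prod_range, ← Fin.prod_const, ← Finset.prod_mul_distrib]
        refine Finset.prod_congr rfl fun j _ => ?_
        rw [Matrix.charmatrix_apply_ne _ _ _ (Fin.castSucc_lt_succ).ne']
        simp
      rw [hprod, hvec, Fin.val_last, hrec, Finset.sum_range_succ, add_sub_cancel_left,
        Finset.prod_range_succ, C_mul]
      have hsq : ((-1 : R[X]) ^ n) * (-1) ^ n = 1 := by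
        rw [← mul_pow]; simp
      linear_combination (C (H (n + 1) n) * w (n + 1) * C (∏ c ∈ Finset.range n, H (c + 1) c)) * hsq
    · intro i j hij
      rw [Matrix.charmatrix_apply_ne _ _ _ (by rintro rfl; omega)]
      simp [hH _ _ hij]
    · intro j
      rw [hvec, Fin.val_castSucc, hrec, sub_eq_zero]
      refine Finset.sum_subset (fun r => by simp; omega) fun r _ hr => ?_
      rw [hH r j (by simp at hr; omega)]
      simp

end Hessenberg

theorem nsum_succ (k : ℕ → ℕ) (i : ℕ) : nsum k (i + 1) = nsum k i + k i :=
  Finset.sum_range_succ _ _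

section Blocks

variable {k : ℕ → ℕ}

theorem nsum_strictMono (hk : ∀ j, 1 ≤ k j) : StrictMono (nsum k) :=
  strictMono_nat_of_lt_succ fun i => by rw [nsum_succ]; have := hk i; omega

theorem blkIdx_nsum_add (hk : ∀ j, 1 ≤ k j) {i a : ℕ} (ha : a < k i) :
    blkIdx k (nsum k i + a) = i := by
  rw [blkIdx, Nat.findGreatest_eq_iff]
  refine ⟨(nsum_strictMono hk).le_apply.trans (Nat.le_add_right _ _), fun _ => by omega,
    fun j hij _ => ?_⟩
  have := (nsum_strictMono hk).monotone (show i + 1 ≤ j from hij)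
  rw [nsum_succ] at this
  omega

theorem exists_eq_nsum_add (hk : ∀ j, 1 ≤ k j) (r : ℕ) : ∃ i a, a < k i ∧ r = nsum k i + a := by
  induction r with
  | zero => exact ⟨0, 0, hk 0, by simp [nsum]⟩
  | succ r ih =>
    obtain ⟨i, a, ha, rfl⟩ := ih
    rcases Nat.lt_or_ge (a + 1) (k i) with h | h
    · exact ⟨i, a + 1, h, by omega⟩
    · exact ⟨i + 1, 0, hk _, by rw [nsum_succ]; omega⟩

theorem sum_range_nsum {M : Type*} [AddCommMonoid M] (f : ℕ → M) (m : ℕ) :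
    ∑ r ∈ Finset.range (nsum k m), f r
      = ∑ i ∈ Finset.range m, ∑ a ∈ Finset.range (k i), f (nsum k i + a) := by
  induction m with
  | zero => simp [nsum]
  | succ m ih => rw [nsum_succ, Finset.sum_range_add, ih, Finset.sum_range_succ]

theorem prod_range_nsum {M : Type*} [CommMonoid M] (f : ℕ → M) (m : ℕ) :
    ∏ r ∈ Finset.range (nsum k m), f r
      = ∏ i ∈ Finset.range m, ∏ a ∈ Finset.range (k i), f (nsum k i + a) := by
  induction m with
  | zero => simp [nsum]
  | succ m ih => rw [nsum_succ, Finset.prod_range_add, ih, Finset.prod_range_succ]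

variable (ε b : ℕ → ℝ) (p : ℕ → Polynomial ℝ)

theorem Jentry_nsum_add (hk : ∀ j, 1 ≤ k j) {i i' a a' : ℕ} (ha : a < k i) (ha' : a' < k i') :
    Jentry ε b p k (nsum k i + a) (nsum k i' + a') =
      if i = i' then
        (if a' = k i - 1 then -((p i).coeff a) else if a = a' + 1 then 1 else 0)
      else if i = i' + 1 then
        (if a = 0 ∧ a' = k i' - 1 then b i' else 0)
      else if i' = i + 1 then
        (if a = 0 ∧ a' = k i' - 1 then ε i * ε i' * b i else 0)
      else 0 := by
  simp only [Jentry, blkIdx_nsum_add hk ha, blkIdx_nsum_add hk ha', Nat.add_sub_cancel_left]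

theorem Jentry_eq_zero (hk : ∀ j, 1 ≤ k j) (r c : ℕ) (h : c + 1 < r) :
    Jentry ε b p k r c = 0 := by
  obtain ⟨i, a, ha, rfl⟩ := exists_eq_nsum_add hk r
  obtain ⟨j, d, hd, rfl⟩ := exists_eq_nsum_add hk c
  rw [Jentry_nsum_add ε b p hk ha hd]
  have hij : j ≤ i := by
    by_contra! hlt
    have := (nsum_strictMono hk).monotone (show i + 1 ≤ j from hlt)
    rw [nsum_succ] at this
    omega
  split_ifs with h1 h2 h3 h4 h5 h6 h7
  · subst h1; omega
  · subst h1; omega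
  · rfl
  · subst h4; rw [nsum_succ] at h; omega
  · rfl
  · omega
  · rfl
  · rfl

theorem Jentry_last_subdiag (hk : ∀ j, 1 ≤ k j) (i : ℕ) :
    Jentry ε b p k (nsum k (i + 1)) (nsum k i + (k i - 1)) = b i := by
  have h := Jentry_nsum_add ε b p hk (i := i + 1) (i' := i) (a := 0) (a' := k i - 1) (hk _)
    (by have := hk i; omega)
  simpa using h

theorem prod_Jentry_subdiag (hk : ∀ j, 1 ≤ k j) (m : ℕ) :
    ∏ c ∈ Finset.range (nsum k m), Jentry ε b p k (c + 1) c = ∏ i ∈ Finset.range m, b i := by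
  rw [prod_range_nsum]
  refine Finset.prod_congr rfl fun i _ => ?_
  have hki := hk i
  rw [Finset.prod_eq_single (k i - 1)]
  · have h := Jentry_last_subdiag ε b p hk i
    rwa [nsum_succ, show nsum k i + k i = nsum k i + (k i - 1) + 1 by omega] at h
  · intro a ha hne
    rw [Finset.mem_range] at ha
    rw [add_assoc, Jentry_nsum_add ε b p hk (by omega) ha]
    simp [hne]
  · intro h
    simp at h
    omega

/-- The entry at position `nsum k i + a` is `X ^ a * P_i`. -/
noncomputable def leftVec (ε b : ℕ → ℝ) (p : ℕ → Polynomial ℝ) (k : ℕ → ℕ) (r : ℕ) :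
    Polynomial ℝ :=
  X ^ (r - nsum k (blkIdx k r)) * genP ε b p (blkIdx k r)

theorem leftVec_nsum_add (hk : ∀ j, 1 ≤ k j) {i a : ℕ} (ha : a < k i) :
    leftVec ε b p k (nsum k i + a) = X ^ a * genP ε b p i := by
  simp only [leftVec, blkIdx_nsum_add hk ha, Nat.add_sub_cancel_left]

theorem leftVec_nsum (hk : ∀ j, 1 ≤ k j) (i : ℕ) :
    leftVec ε b p k (nsum k i) = genP ε b p i := by
  simpa using leftVec_nsum_add ε b p hk (hk i)

theorem C_mul_genP_succ (hb : ∀ j, b j ≠ 0) (i : ℕ) :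
    C (b (i + 1)) * genP ε b p (i + 2)
      = p (i + 1) * genP ε b p (i + 1) - C (ε i * ε (i + 1) * b i) * genP ε b p i := by
  rw [genP, ← mul_assoc, ← C_mul, mul_inv_cancel₀ (hb _), C_1, one_mul]

theorem sum_diagBlock_last (hp : ∀ j, (p j).Monic) (hdeg : ∀ j, (p j).natDegree = k j)
    (hk : ∀ j, 1 ≤ k j) (i : ℕ) :
    ∑ a ∈ Finset.range (k i), C (Jentry ε b p k (nsum k i + a) (nsum k i + (k i - 1))) *
        leftVec ε b p k (nsum k i + a)
      = (X ^ k i - p i) * genP ε b p i := by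
  have hki := hk i
  have hpi : p i = X ^ k i + ∑ a ∈ Finset.range (k i), C ((p i).coeff a) * X ^ a := by
    conv_lhs => rw [(hp i).as_sum, hdeg i]
  have hsum : X ^ k i - p i = -∑ a ∈ Finset.range (k i), C ((p i).coeff a) * X ^ a := by
    linear_combination -hpi
  rw [hsum, neg_mul, Finset.sum_mul, ← Finset.sum_neg_distrib]
  refine Finset.sum_congr rfl fun a ha => ?_
  rw [Finset.mem_range] at ha
  rw [Jentry_nsum_add ε b p hk ha (by omega), leftVec_nsum_add ε b p hk ha]
  simp
  ring

theorem sum_superdiagBlock_last (hk : ∀ j, 1 ≤ k j) (i : ℕ) :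
    ∑ a ∈ Finset.range (k i), C (Jentry ε b p k (nsum k i + a)
        (nsum k (i + 1) + (k (i + 1) - 1))) * leftVec ε b p k (nsum k i + a)
      = C (ε i * ε (i + 1) * b i) * genP ε b p i := by
  have hki := hk (i + 1)
  rw [Finset.sum_eq_single 0]
  · rw [Jentry_nsum_add ε b p hk (hk i) (by omega), leftVec_nsum_add ε b p hk (hk i),
      if_neg (by omega), if_neg (by omega), if_pos rfl, if_pos ⟨rfl, rfl⟩, pow_zero, one_mul]
  · intro a ha hne
    rw [Finset.mem_range] at ha
    rw [Jentry_nsum_add ε b p hk ha (by omega)]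
    simp [hne]
  · intro h
    have := hk i
    simp at h
    omega

theorem X_mul_leftVec (hb : ∀ j, b j ≠ 0) (hp : ∀ j, (p j).Monic)
    (hdeg : ∀ j, (p j).natDegree = k j) (hk : ∀ j, 1 ≤ k j) (c : ℕ) :
    X * leftVec ε b p k c
      = ∑ r ∈ Finset.range (c + 2), C (Jentry ε b p k r c) * leftVec ε b p k r := by
  obtain ⟨i, d, hd, rfl⟩ := exists_eq_nsum_add hk c
  rcases Nat.lt_or_ge (d + 1) (k i) with h | h
  · rw [Finset.sum_range_succ, Finset.sum_eq_zero, zero_add, add_assoc,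
      Jentry_nsum_add ε b p hk h hd, leftVec_nsum_add ε b p hk h, leftVec_nsum_add ε b p hk hd]
    · simp [show d ≠ k i - 1 by omega]
      ring
    · intro r hr
      rw [Finset.mem_range] at hr
      obtain ⟨j, a, ha, rfl⟩ := exists_eq_nsum_add hk r
      rw [Jentry_nsum_add ε b p hk ha hd]
      have hji : j ≠ i + 1 := by
        rintro rfl
        rw [nsum_succ] at hr
        omega
      split_ifs <;> first | (subst_vars; omega) | simp
  · obtain rfl : d = k i - 1 := by omega
    have hX : X * leftVec ε b p k (nsum k i + (k i - 1)) = X ^ k i * genP ε b p i := by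
      rw [leftVec_nsum_add ε b p hk hd, ← mul_assoc, ← pow_succ',
        show k i - 1 + 1 = k i by omega]
    rw [hX, show nsum k i + (k i - 1) + 2 = nsum k (i + 1) + 1 by rw [nsum_succ]; omega,
      Finset.sum_range_succ, Jentry_last_subdiag ε b p hk, leftVec_nsum ε b p hk, sum_range_nsum,
      Finset.sum_range_succ, sum_diagBlock_last ε b p hp hdeg hk]
    cases i with
    | zero =>
      have h1 : C (b 0) * genP ε b p 1 = p 0 := by
        rw [genP, ← mul_assoc, ← C_mul, mul_inv_cancel₀ (hb _), C_1, one_mul]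
      rw [zero_add, h1, genP]
      simp
    | succ i =>
      rw [Finset.sum_range_succ, sum_superdiagBlock_last ε b p hk, Finset.sum_eq_zero,
        C_mul_genP_succ ε b p hb]
      · ring
      · intro j hj
        rw [Finset.mem_range] at hj
        refine Finset.sum_eq_zero fun a ha => ?_
        rw [Finset.mem_range] at ha
        rw [Jentry_nsum_add ε b p hk ha hd, if_neg (by omega), if_neg (by omega),
          if_neg (by omega), C_0, zero_mul]

/-- Determinant formula for the polynomials of the first kind. -/
theorem charpoly_JmatN (hb : ∀ j, b j ≠ 0) (hp : ∀ j, (p j).Monic)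
    (hdeg : ∀ j, (p j).natDegree = k j) (hk : ∀ j, 1 ≤ k j) (m : ℕ) :
    (JmatN ε b p k m).charpoly = C (∏ i ∈ Finset.range m, b i) * genP ε b p m := by
  have h0 : leftVec ε b p k 0 = 1 := by
    simpa [nsum, genP] using leftVec_nsum ε b p hk 0
  rw [JmatN, Matrix.charpoly_of_upperHessenberg (Jentry ε b p k) _ h0 (Jentry_eq_zero ε b p hk)
    (X_mul_leftVec ε b p hb hp hdeg hk), prod_Jentry_subdiag ε b p hk, leftVec_nsum ε b p hk]

end Blocks

theorem genQ_succ (ε b : ℕ → ℝ) (p : ℕ → Polynomial ℝ) (j : ℕ) :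
    genQ ε b p (j + 1) = C (ε 0 / b 0) *
      genP (fun i => ε (i + 1)) (fun i => b (i + 1)) (fun i => p (i + 1)) j := by
  induction j using Nat.twoStepInduction with
  | zero => simp [genP, genQ]
  | one =>
    simp only [genP, genQ]
    ring
  | more j ih1 ih2 =>
    rw [genQ, ih1, ih2, genP]
    ring

/-- Determinant formula for the polynomials of the second kind: for every `j ≥ 1`,
`Q_j(λ) = ε_0 (b_0 ⋯ b_{j-1})⁻¹ · det(λ·I − H_{[1,j-1]})`, where `H_{[1,j-1]}` is the
generalized Jacobi matrix built from the shifted data (blocks `1, …, j-1`), i.e.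
`JmatN` applied to the shifted sequences with `j-1` blocks; for `j = 1` it is the
empty `0 × 0` matrix, whose characteristic polynomial is `1`. -/
theorem genQ_eq_charpoly (ε b : ℕ → ℝ) (p : ℕ → Polynomial ℝ) (k : ℕ → ℕ)
    (hε : ∀ j, ε j = 1 ∨ ε j = -1) (hb : ∀ j, 0 < b j)
    (hp : ∀ j, (p j).Monic) (hdeg : ∀ j, (p j).natDegree = k j) (hk : ∀ j, 1 ≤ k j) :
    ∀ j : ℕ, 1 ≤ j →
      genQ ε b p j =
        Polynomial.C (ε 0 * (∏ i ∈ Finset.range j, b i)⁻¹) *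
          (JmatN (fun i => ε (i + 1)) (fun i => b (i + 1)) (fun i => p (i + 1))
            (fun i => k (i + 1)) (j - 1)).charpoly := by
  intro j hj
  obtain ⟨m, rfl⟩ := Nat.exists_eq_add_of_le' hj
  rw [genQ_succ, Nat.add_sub_cancel, charpoly_JmatN _ _ _ (fun i => (hb (i + 1)).ne')
    (fun i => hp (i + 1)) (fun i => hdeg (i + 1)) (fun i => hk (i + 1)), ← mul_assoc, ← C_mul,
    Finset.prod_range_succ']
  congr 2
  have h0 := (hb 0).ne'
  have hprod : ∏ i ∈ Finset.range m, b (i + 1) ≠ 0 :=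
    Finset.prod_ne_zero_iff.mpr fun i _ => (hb (i + 1)).ne'
  field_simp
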